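/- Let T = V₁ − V₂, where V₁ ~ χ'²_r(λ₁) and V₂ ~ χ'²_r(0) are independent, with r > 0 and λ₁ ≥ 0 (i.e. λ₂ = 0), and let W be a real-valued random variable with E|W| < ∞. Define the operator A₂ by A₂f(x) = 8x f‴(x) + (8r − 4x) f″(x) − (2x + 4r + 2λ₁) f′(x) + (x − λ₁) f(x). Then W has the same distribution as T if and only if E[A₂f(W)] = 0 for all f ∈ F₃(W). -/

import Mathlib

open MeasureTheory ProbabilityTheory Real

noncomputable section

/-- Modified Bessel function of the first kind,
`I ν y = ∑_{k=0}^∞ (y/2)^{2k+ν} / (k! Γ(k+ν+1))`. -/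
def besselI (ν y : ℝ) : ℝ :=
  ∑' k : ℕ, (y / 2) ^ (2 * (k : ℝ) + ν) / ((k.factorial : ℝ) * Real.Gamma ((k : ℝ) + ν + 1))

/-- The density of the noncentral chi-square distribution with `r` degrees of freedom and
noncentrality parameter `lam` (for `lam = 0`, the chi-square density). -/
def ncChiSqPdf (r lam x : ℝ) : ℝ :=
  if x ≤ 0 then 0
  else if lam = 0 then x ^ (r / 2 - 1) * Real.exp (-x / 2) / (2 ^ (r / 2) * Real.Gamma (r / 2))
  else (1 / 2) * Real.exp (-(x + lam) / 2) * (x / lam) ^ (r / 4 - 1 / 2) *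
    besselI (r / 2 - 1) (Real.sqrt (lam * x))

/-- The noncentral chi-square distribution `χ'²_r(lam)` as a measure on `ℝ`. -/
def ncChiSq (r lam : ℝ) : Measure ℝ :=
  volume.withDensity fun x => ENNReal.ofReal (ncChiSqPdf r lam x)

/-- The law of the difference `T = V₁ - V₂` of independent noncentral chi-square random
variables `V₁ ~ χ'²_r(λ₁)` and `V₂ ~ χ'²_r(λ₂)`. -/
def ncChiSqDiff (r lam1 lam2 : ℝ) : Measure ℝ :=
  Measure.map (fun p : ℝ × ℝ => p.1 - p.2) ((ncChiSq r lam1).prod (ncChiSq r lam2))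

/-- A bounded continuous real function. -/
def BddCont (g : ℝ → ℝ) : Prop := Continuous g ∧ ∃ C, ∀ x, |g x| ≤ C

namespace BddCont

variable {g h : ℝ → ℝ}

lemma add (hg : BddCont g) (hh : BddCont h) : BddCont fun x => g x + h x := by
  obtain ⟨hg, C, hC⟩ := hg
  obtain ⟨hh, D, hD⟩ := hh
  exact ⟨hg.add hh, C + D, fun x => (abs_add_le _ _).trans (add_le_add (hC x) (hD x))⟩

lemma const_mul (c : ℝ) (hg : BddCont g) : BddCont fun x => c * g x := by
  obtain ⟨hg, C, hC⟩ := hg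
  refine ⟨continuous_const.mul hg, |c| * C, fun x => ?_⟩
  rw [abs_mul]
  exact mul_le_mul_of_nonneg_left (hC x) (abs_nonneg c)

lemma sub (hg : BddCont g) (hh : BddCont h) : BddCont fun x => g x - h x := by
  have := hg.add (hh.const_mul (-1))
  simpa [sub_eq_add_neg] using this

lemma comp (hg : BddCont g) {u : ℝ → ℝ} (hu : Continuous u) : BddCont fun x => g (u x) :=
  ⟨hg.1.comp hu, hg.2.choose, fun x => hg.2.choose_spec (u x)⟩

lemma integrable_comp (hg : BddCont g) {Ω : Type*} [MeasurableSpace Ω] {μ : Measure Ω}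
    [IsFiniteMeasure μ] {u : Ω → ℝ} (hu : AEMeasurable u μ) : Integrable (fun ω => g (u ω)) μ := by
  obtain ⟨hg, C, hC⟩ := hg
  exact Integrable.of_bound (hg.measurable.comp_aemeasurable hu).aestronglyMeasurable C
    (ae_of_all _ fun ω => hC _)

lemma integrable_mul_comp (hg : BddCont g) {Ω : Type*} [MeasurableSpace Ω] {μ : Measure Ω}
    {u v : Ω → ℝ} (hu : AEMeasurable u μ) (hv : Integrable v μ) :
    Integrable (fun ω => v ω * g (u ω)) μ := by
  obtain ⟨hg, C, hC⟩ := hg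
  exact hv.mul_bdd (c := C) (hg.measurable.comp_aemeasurable hu).aestronglyMeasurable
    (ae_of_all _ fun ω => hC _)

end BddCont

lemma measurable_gammaPDF (a b : ℝ) : Measurable (gammaPDF a b) :=
  (measurable_gammaPDFReal a b).ennreal_ofReal

lemma integral_gammaMeasure {a : ℝ} (ha : 0 < a) (g : ℝ → ℝ) :
    ∫ x, g x ∂gammaMeasure a (1 / 2) = ∫ x in Set.Ioi 0, gammaPDFReal a (1 / 2) x * g x := by
  rw [gammaMeasure, integral_withDensity_eq_integral_toReal_smul
    (measurable_gammaPDF _ _) (ae_of_all _ fun x => ENNReal.ofReal_lt_top),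
    ← integral_Ici_eq_integral_Ioi, setIntegral_eq_integral_of_forall_compl_eq_zero]
  · refine integral_congr_ae (ae_of_all _ fun x => ?_)
    simp only
    rw [show (gammaPDF a (1 / 2) x).toReal = gammaPDFReal a (1 / 2) x from
      ENNReal.toReal_ofReal (gammaPDFReal_nonneg ha one_half_pos x), smul_eq_mul]
  · intro x hx
    have : ¬ 0 ≤ x := hx
    simp [gammaPDFReal, this]

lemma integrable_gammaPDFReal {a : ℝ} (ha : 0 < a) : Integrable (gammaPDFReal a (1 / 2)) := by
  refine ⟨(measurable_gammaPDFReal _ _).aestronglyMeasurable, ?_⟩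
  rw [hasFiniteIntegral_iff_ofReal (ae_of_all _ (gammaPDFReal_nonneg ha one_half_pos))]
  exact (lintegral_gammaPDF_eq_one ha one_half_pos).trans_lt ENNReal.one_lt_top

lemma mul_gammaPDFReal {a : ℝ} (ha : 0 < a) {x : ℝ} :
    x * gammaPDFReal a (1 / 2) x = 2 * a * gammaPDFReal (a + 1) (1 / 2) x := by
  unfold gammaPDFReal
  split_ifs with hx
  · rcases hx.eq_or_lt with rfl | hx
    · simp [zero_rpow ha.ne']
    · rw [Real.Gamma_add_one ha.ne', rpow_add_one (by norm_num), add_sub_cancel_right,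
        rpow_sub_one hx.ne']
      have := (Real.Gamma_pos_of_pos ha).ne'
      field_simp
  · simp

lemma hasDerivAt_gammaPDFReal {a : ℝ} (ha : 0 < a) {x : ℝ} (hx : 0 < x) :
    HasDerivAt (gammaPDFReal (a + 1) (1 / 2))
      ((gammaPDFReal a (1 / 2) x - gammaPDFReal (a + 1) (1 / 2) x) / 2) x := by
  have h1 : HasDerivAt (fun y : ℝ => (1 / 2 : ℝ) ^ (a + 1) / Real.Gamma (a + 1) * y ^ a *
      Real.exp (-(1 / 2 * y)))
      ((1 / 2 : ℝ) ^ (a + 1) / Real.Gamma (a + 1) * (a * x ^ (a - 1)) * Real.exp (-(1 / 2 * x)) +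
      (1 / 2 : ℝ) ^ (a + 1) / Real.Gamma (a + 1) * x ^ a *
        (Real.exp (-(1 / 2 * x)) * -(1 / 2 * 1))) x :=
    (((hasDerivAt_rpow_const (Or.inl hx.ne')).const_mul _).mul
      (((hasDerivAt_id x).const_mul (1 / 2 : ℝ)).neg.exp))
  refine (h1.congr_of_eventuallyEq ?_).congr_deriv ?_
  · filter_upwards [lt_mem_nhds hx] with y hy
    simp [gammaPDFReal, hy.le]
  · simp only [gammaPDFReal, hx.le, if_true, add_sub_cancel_right]
    rw [Real.Gamma_add_one ha.ne', rpow_add_one (by norm_num)]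
    have := (Real.Gamma_pos_of_pos ha).ne'
    field_simp
    ring

lemma tendsto_gammaPDFReal_atTop (a : ℝ) :
    Filter.Tendsto (gammaPDFReal a (1 / 2)) Filter.atTop (nhds 0) := by
  have h := (tendsto_rpow_mul_exp_neg_mul_atTop_nhds_zero (a - 1) (1 / 2) one_half_pos).const_mul
    ((1 / 2 : ℝ) ^ a / Real.Gamma a)
  rw [mul_zero] at h
  refine h.congr' ?_
  filter_upwards [Filter.eventually_ge_atTop 0] with x hx
  simp only [gammaPDFReal, hx, if_true, neg_mul, mul_assoc]

lemma continuousWithinAt_gammaPDFReal_zero {a : ℝ} (ha : 0 < a) :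
    ContinuousWithinAt (gammaPDFReal (a + 1) (1 / 2)) (Set.Ici 0) 0 := by
  have h : ContinuousAt (fun y : ℝ => (1 / 2 : ℝ) ^ (a + 1) / Real.Gamma (a + 1) * y ^ a *
      Real.exp (-(1 / 2 * y))) 0 :=
    (continuousAt_const.mul (continuousAt_rpow_const 0 a (Or.inr ha.le))).mul (by fun_prop)
  refine h.continuousWithinAt.congr (fun y hy => ?_) ?_
  · simp [gammaPDFReal, Set.mem_Ici.1 hy]
  · simp [gammaPDFReal]

/-- The Stein identity linking chi-square laws whose degrees of freedom differ by two. -/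
lemma integral_gammaMeasure_add_one {a : ℝ} (ha : 0 < a) {g g' : ℝ → ℝ}
    (hd : ∀ x, HasDerivAt g (g' x) x) (hg : BddCont g) (hg' : BddCont g') :
    ∫ x, (g x - 2 * g' x) ∂gammaMeasure (a + 1) (1 / 2) = ∫ x, g x ∂gammaMeasure a (1 / 2) := by
  rw [integral_gammaMeasure (by positivity), integral_gammaMeasure ha]
  have hi : ∀ {b : ℝ}, 0 < b → ∀ {h : ℝ → ℝ}, BddCont h →
      IntegrableOn (fun x => gammaPDFReal b (1 / 2) x * h x) (Set.Ioi 0) := fun hb _ hh =>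
    (hh.integrable_mul_comp (u := id) aemeasurable_id (integrable_gammaPDFReal hb)).integrableOn
  have ha1 : 0 < a + 1 := by positivity
  have key := integral_Ioi_of_hasDerivAt_of_tendsto (a := 0) (m := 0)
    (f := fun x => gammaPDFReal (a + 1) (1 / 2) x * g x)
    (f' := fun x => (gammaPDFReal a (1 / 2) x - gammaPDFReal (a + 1) (1 / 2) x) / 2 * g x +
      gammaPDFReal (a + 1) (1 / 2) x * g' x)
    ((continuousWithinAt_gammaPDFReal_zero ha).mul hg.1.continuousWithinAt)
    (fun x hx => (hasDerivAt_gammaPDFReal ha hx).mul (hd x))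
    ((((hi ha hg).sub (hi ha1 hg)).div_const 2 |>.add (hi ha1 hg')).congr
      (ae_of_all _ fun x => by simp only [Pi.add_apply, Pi.sub_apply]; ring))
    (by
      obtain ⟨C, hC⟩ := hg.2
      exact (tendsto_gammaPDFReal_atTop _).zero_mul_isBoundedUnder_le
        (Filter.isBoundedUnder_of ⟨C, hC⟩))
  have h0 : gammaPDFReal (a + 1) (1 / 2) 0 = 0 := by simp [gammaPDFReal, zero_rpow ha.ne']
  rw [h0, zero_mul, sub_zero] at key
  rw [← sub_eq_zero, ← integral_sub (hi ha1 (hg.sub (hg'.const_mul 2))) (hi ha hg)]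
  refine (integral_congr_ae (ae_of_all _ fun x => ?_)).trans
    ((integral_const_mul (-2) _).trans (by rw [key, mul_zero]))
  ring

/-- The Poisson weights with mean `lam / 2`. -/
def poissonWeight (lam : ℝ) (k : ℕ) : ℝ := Real.exp (-(lam / 2)) * (lam / 2) ^ k / k.factorial

/-- The Poisson mixture of the gamma laws of shape `a + k` and rate `1 / 2`. -/
def gammaMixture (a lam : ℝ) : Measure ℝ :=
  Measure.sum fun k : ℕ => ENNReal.ofReal (poissonWeight lam k) • gammaMeasure (a + k) (1 / 2)

lemma poissonWeight_nonneg {lam : ℝ} (hl : 0 ≤ lam) (k : ℕ) : 0 ≤ poissonWeight lam k := by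
  unfold poissonWeight
  positivity

lemma hasSum_poissonWeight (lam : ℝ) : HasSum (poissonWeight lam) 1 := by
  have h := (NormedSpace.expSeries_div_hasSum_exp (lam / 2)).mul_left (Real.exp (-(lam / 2)))
  rw [← Real.exp_eq_exp_ℝ, ← Real.exp_add, neg_add_cancel, Real.exp_zero] at h
  convert! h using 2
  simp [poissonWeight, mul_div_assoc]

lemma two_mul_succ_mul_poissonWeight_succ (lam : ℝ) (k : ℕ) :
    2 * ((k : ℝ) + 1) * poissonWeight lam (k + 1) = lam * poissonWeight lam k := by
  simp only [poissonWeight, Nat.factorial_succ, pow_succ]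
  push_cast
  field_simp

lemma isProbabilityMeasure_gammaMixture {a lam : ℝ} (ha : 0 < a) (hl : 0 ≤ lam) :
    IsProbabilityMeasure (gammaMixture a lam) := by
  constructor
  rw [gammaMixture, Measure.sum_apply _ MeasurableSet.univ]
  have : ∀ k : ℕ, (ENNReal.ofReal (poissonWeight lam k) • gammaMeasure (a + k) (1 / 2)) Set.univ
      = ENNReal.ofReal (poissonWeight lam k) := fun k => by
    have := isProbabilityMeasure_gammaMeasure (a := a + k) (by positivity) one_half_pos
    rw [Measure.smul_apply, measure_univ, smul_eq_mul, mul_one]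
  simp_rw [this]
  rw [← ENNReal.ofReal_tsum_of_nonneg (poissonWeight_nonneg hl) (hasSum_poissonWeight lam).summable,
    (hasSum_poissonWeight lam).tsum_eq, ENNReal.ofReal_one]

lemma integral_gammaMixture_add_one {a lam : ℝ} (ha : 0 < a) (hl : 0 ≤ lam) {g g' : ℝ → ℝ}
    (hd : ∀ x, HasDerivAt g (g' x) x) (hg : BddCont g) (hg' : BddCont g') :
    ∫ x, (g x - 2 * g' x) ∂gammaMixture (a + 1) lam = ∫ x, g x ∂gammaMixture a lam := by
  have := isProbabilityMeasure_gammaMixture ha hl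
  have := isProbabilityMeasure_gammaMixture (a := a + 1) (by positivity) hl
  have h1 := hasSum_integral_measure
    ((hg.sub (hg'.const_mul 2)).integrable_comp (μ := gammaMixture (a + 1) lam) aemeasurable_id)
  have h2 := hasSum_integral_measure
    (hg.integrable_comp (μ := gammaMixture a lam) aemeasurable_id)
  refine h1.unique ?_
  convert! h2 using 2 with k
  rw [integral_smul_measure, integral_smul_measure, add_right_comm]
  congr 1
  exact integral_gammaMeasure_add_one (by positivity) hd hg hg'

lemma withDensity_gammaMeasure {a : ℝ} (ha : 0 < a) :
    (gammaMeasure a (1 / 2)).withDensity ENNReal.ofReal =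
      ENNReal.ofReal (2 * a) • gammaMeasure (a + 1) (1 / 2) := by
  rw [gammaMeasure, gammaMeasure, ← withDensity_mul _ (measurable_gammaPDF _ _)
    ENNReal.measurable_ofReal, ← withDensity_smul _ (measurable_gammaPDF _ _)]
  congr 1 with x
  simp only [Pi.mul_apply, Pi.smul_apply, smul_eq_mul, gammaPDF]
  rw [mul_comm, ← ENNReal.ofReal_mul' (gammaPDFReal_nonneg ha one_half_pos x), mul_gammaPDFReal ha,
    ENNReal.ofReal_mul (by positivity)]

lemma tsum_poissonWeight_mul {a lam : ℝ} (ha : 0 ≤ a) (hl : 0 ≤ lam) (c : ℕ → ENNReal) :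
    ∑' k : ℕ, ENNReal.ofReal (poissonWeight lam k) * (ENNReal.ofReal (2 * (a + k)) * c k) =
      ENNReal.ofReal (2 * a) * ∑' k : ℕ, ENNReal.ofReal (poissonWeight lam k) * c k +
        ENNReal.ofReal lam * ∑' k : ℕ, ENNReal.ofReal (poissonWeight lam k) * c (k + 1) := by
  have h1 : ∀ k : ℕ, ENNReal.ofReal (poissonWeight lam k) *
      (ENNReal.ofReal (2 * (a + k)) * c k) =
      ENNReal.ofReal (2 * a) * (ENNReal.ofReal (poissonWeight lam k) * c k) +
      ENNReal.ofReal (2 * k * poissonWeight lam k) * c k := fun k => by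
    rw [mul_add 2 a, ENNReal.ofReal_add (by positivity) (by positivity),
      ENNReal.ofReal_mul (p := 2 * (k : ℝ)) (by positivity)]
    ring
  rw [tsum_congr h1, ENNReal.tsum_add, ENNReal.tsum_mul_left]
  congr 1
  rw [tsum_eq_zero_add' ENNReal.summable, ← ENNReal.tsum_mul_left]
  simp only [Nat.cast_zero, mul_zero, zero_mul, ENNReal.ofReal_zero, zero_add]
  refine tsum_congr fun k => ?_
  rw [Nat.cast_succ, two_mul_succ_mul_poissonWeight_succ, ENNReal.ofReal_mul hl, mul_assoc]

lemma withDensity_gammaMixture {a lam : ℝ} (ha : 0 < a) (hl : 0 ≤ lam) :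
    (gammaMixture a lam).withDensity ENNReal.ofReal =
      ENNReal.ofReal (2 * a) • gammaMixture (a + 1) lam +
        ENNReal.ofReal lam • gammaMixture (a + 2) lam := by
  ext s hs
  have h0 : (gammaMixture a lam).withDensity ENNReal.ofReal s =
      ∑' k : ℕ, ENNReal.ofReal (poissonWeight lam k) *
        (ENNReal.ofReal (2 * (a + k)) * gammaMeasure (a + 1 + k) (1 / 2) s) := by
    rw [gammaMixture, withDensity_sum, Measure.sum_apply _ hs]
    refine tsum_congr fun k => ?_
    rw [withDensity_smul_measure, withDensity_gammaMeasure (by positivity), Measure.smul_apply,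
      Measure.smul_apply, smul_eq_mul, smul_eq_mul, add_right_comm a]
  have h1 : gammaMixture (a + 1) lam s = ∑' k : ℕ, ENNReal.ofReal (poissonWeight lam k) *
      gammaMeasure (a + 1 + k) (1 / 2) s := by
    rw [gammaMixture, Measure.sum_apply _ hs]
    rfl
  have h2 : gammaMixture (a + 2) lam s = ∑' k : ℕ, ENNReal.ofReal (poissonWeight lam k) *
      gammaMeasure (a + 1 + (k + 1 : ℕ)) (1 / 2) s := by
    rw [gammaMixture, Measure.sum_apply _ hs]
    refine tsum_congr fun k => ?_
    rw [Measure.smul_apply, smul_eq_mul, show a + 2 + (k : ℝ) = a + 1 + (k + 1 : ℕ) by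
      push_cast; ring]
  rw [h0, tsum_poissonWeight_mul ha.le hl fun k : ℕ => gammaMeasure (a + 1 + k) (1 / 2) s,
    Measure.add_apply, Measure.smul_apply, Measure.smul_apply, smul_eq_mul, smul_eq_mul, h1, h2]

lemma gammaMixture_ae_nonneg (a lam : ℝ) : ∀ᵐ x ∂gammaMixture a lam, 0 ≤ x := by
  rw [gammaMixture, Measure.ae_sum_iff]
  intro k
  refine Measure.ae_smul_measure ?_ _
  rw [gammaMeasure, ae_withDensity_iff (measurable_gammaPDF _ _)]
  refine ae_of_all _ fun x hx => ?_
  by_contra h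
  exact hx (gammaPDF_of_neg (not_le.1 h))

lemma integrable_id_gammaMixture {a lam : ℝ} (ha : 0 < a) (hl : 0 ≤ lam) :
    Integrable (fun x => x) (gammaMixture a lam) := by
  refine ⟨aestronglyMeasurable_id, ?_⟩
  rw [hasFiniteIntegral_iff_ofReal (gammaMixture_ae_nonneg a lam), ← setLIntegral_univ,
    ← withDensity_apply _ MeasurableSet.univ, withDensity_gammaMixture ha hl]
  have := isProbabilityMeasure_gammaMixture (a := a + 1) (by positivity) hl
  have := isProbabilityMeasure_gammaMixture (a := a + 2) (by positivity) hl
  simp [ENNReal.add_lt_top, ENNReal.mul_lt_top]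

lemma integral_mul_gammaMixture {a lam : ℝ} (ha : 0 < a) (hl : 0 ≤ lam) {g : ℝ → ℝ}
    (hg : BddCont g) :
    ∫ x, x * g x ∂gammaMixture a lam =
      2 * a * ∫ x, g x ∂gammaMixture (a + 1) lam + lam * ∫ x, g x ∂gammaMixture (a + 2) lam := by
  have := isProbabilityMeasure_gammaMixture (a := a + 1) (by positivity) hl
  have := isProbabilityMeasure_gammaMixture (a := a + 2) (by positivity) hl
  have h : ∫ x, x * g x ∂gammaMixture a lam =
      ∫ x, g x ∂(gammaMixture a lam).withDensity ENNReal.ofReal := by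
    rw [integral_withDensity_eq_integral_toReal_smul ENNReal.measurable_ofReal
      (ae_of_all _ fun x => ENNReal.ofReal_lt_top)]
    refine integral_congr_ae ?_
    filter_upwards [gammaMixture_ae_nonneg a lam] with x hx
    simp [ENNReal.toReal_ofReal hx]
  rw [h, withDensity_gammaMixture ha hl, integral_add_measure, integral_smul_measure,
    integral_smul_measure, ENNReal.toReal_ofReal (by positivity), ENNReal.toReal_ofReal hl,
    smul_eq_mul, smul_eq_mul]
  · exact (hg.integrable_comp aemeasurable_id).smul_measure ENNReal.ofReal_ne_top
  · exact (hg.integrable_comp aemeasurable_id).smul_measure ENNReal.ofReal_ne_top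

lemma gammaMixture_zero_stein {a : ℝ} (ha : 0 < a) {g g' : ℝ → ℝ}
    (hd : ∀ x, HasDerivAt g (g' x) x) (hg : BddCont g) (hg' : BddCont g') :
    ∫ x, x * (g x - 2 * g' x) ∂gammaMixture a 0 = 2 * a * ∫ x, g x ∂gammaMixture a 0 := by
  rw [integral_mul_gammaMixture ha le_rfl (hg.sub (hg'.const_mul 2)), zero_mul, add_zero,
    integral_gammaMixture_add_one ha le_rfl hd hg hg']

lemma gammaMixture_stein {a lam : ℝ} (ha : 0 < a) (hl : 0 ≤ lam) {g g' g'' : ℝ → ℝ}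
    (hd : ∀ x, HasDerivAt g (g' x) x) (hd' : ∀ x, HasDerivAt g' (g'' x) x)
    (hg : BddCont g) (hg' : BddCont g') (hg'' : BddCont g'') :
    ∫ x, x * ((g x - 2 * g' x) - 2 * (g' x - 2 * g'' x)) ∂gammaMixture a lam =
      2 * a * ∫ x, (g x - 2 * g' x) ∂gammaMixture a lam + lam * ∫ x, g x ∂gammaMixture a lam := by
  have hb := hg.sub (hg'.const_mul 2)
  have hb' := hg'.sub (hg''.const_mul 2)
  have hbd : ∀ x, HasDerivAt (fun x => g x - 2 * g' x) (g' x - 2 * g'' x) x := fun x =>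
    (hd x).sub ((hd' x).const_mul 2)
  rw [integral_mul_gammaMixture ha hl (hb.sub (hb'.const_mul 2)),
    integral_gammaMixture_add_one ha hl hbd hb hb', show a + 2 = a + 1 + 1 by ring,
    integral_gammaMixture_add_one (by positivity) hl hbd hb hb',
    integral_gammaMixture_add_one ha hl hd hg hg']

lemma ncChiSqPdf_zero_eq (r : ℝ) {x : ℝ} (hx : 0 < x) :
    ncChiSqPdf r 0 x = gammaPDFReal (r / 2) (1 / 2) x := by
  simp only [ncChiSqPdf, not_le.2 hx, hx.le, if_true, if_false, gammaPDFReal]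
  rw [Real.div_rpow zero_le_one zero_le_two, Real.one_rpow]
  ring_nf

lemma besselI_term_eq {r lam x : ℝ} (hl : 0 < lam) (hx : 0 < x) (k : ℕ) :
    (1 / 2) * Real.exp (-(x + lam) / 2) * (x / lam) ^ (r / 4 - 1 / 2) *
      ((Real.sqrt (lam * x) / 2) ^ (2 * (k : ℝ) + (r / 2 - 1)) /
        ((k.factorial : ℝ) * Real.Gamma ((k : ℝ) + (r / 2 - 1) + 1))) =
      poissonWeight lam k * gammaPDFReal (r / 2 + k) (1 / 2) x := by
  have e1 : (Real.sqrt (lam * x) / 2) ^ (2 * (k : ℝ) + (r / 2 - 1)) =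
      lam ^ (k : ℝ) * lam ^ (r / 4 - 1 / 2) * (x ^ (k : ℝ) * x ^ (r / 4 - 1 / 2)) *
        (1 / 2) ^ (2 * (k : ℝ) + (r / 2 - 1)) := by
    rw [div_eq_mul_one_div, Real.mul_rpow (Real.sqrt_nonneg _) (by norm_num), Real.sqrt_eq_rpow,
      ← Real.rpow_mul (by positivity), ← Real.rpow_add hl, ← Real.rpow_add hx,
      Real.mul_rpow hl.le hx.le]
    ring_nf
  have e2 : (1 / 2 : ℝ) ^ (r / 2 + k) * (1 / 2) ^ (k : ℝ) =
      1 / 2 * (1 / 2) ^ (2 * (k : ℝ) + (r / 2 - 1)) := by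
    nth_rw 3 [← Real.rpow_one (1 / 2 : ℝ)]
    rw [← Real.rpow_add one_half_pos, ← Real.rpow_add one_half_pos]
    ring_nf
  have e3 : x ^ (r / 2 + k - 1) = x ^ (r / 4 - 1 / 2) * (x ^ (k : ℝ) * x ^ (r / 4 - 1 / 2)) := by
    rw [← Real.rpow_add hx, ← Real.rpow_add hx]
    ring_nf
  have e4 : Real.exp (-(x + lam) / 2) = Real.exp (-(lam / 2)) * Real.exp (-(1 / 2 * x)) := by
    rw [← Real.exp_add]
    ring_nf
  have e5 : (lam / 2) ^ k = lam ^ (k : ℝ) * (1 / 2) ^ (k : ℝ) := by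
    rw [← Real.mul_rpow hl.le (by norm_num), Real.rpow_natCast]
    ring
  have e6 : (k : ℝ) + (r / 2 - 1) + 1 = r / 2 + k := by ring
  have hne : lam ^ (r / 4 - 1 / 2) ≠ 0 := (Real.rpow_pos_of_pos hl _).ne'
  simp only [poissonWeight, gammaPDFReal, hx.le, if_true]
  rw [e1, e3, e4, e5, e6, Real.div_rpow hx.le hl.le]
  calc _ = (1 / 2 * (1 / 2) ^ (2 * (k : ℝ) + (r / 2 - 1))) * (lam ^ (r / 4 - 1 / 2) /
        lam ^ (r / 4 - 1 / 2)) * (Real.exp (-(lam / 2)) * Real.exp (-(1 / 2 * x)) *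
        x ^ (r / 4 - 1 / 2) * lam ^ (k : ℝ) * (x ^ (k : ℝ) * x ^ (r / 4 - 1 / 2)) /
        ((k.factorial : ℝ) * Real.Gamma (r / 2 + k))) := by ring
    _ = _ := by rw [div_self hne, ← e2]; ring

lemma Gamma_add_nat_lower_bound {a : ℝ} (ha : 0 < a) (k : ℕ) :
    min a 1 * Real.Gamma a ≤ Real.Gamma (a + k) := by
  have hG := Real.Gamma_pos_of_pos ha
  have h : ∀ k : ℕ, a * Real.Gamma a ≤ Real.Gamma (a + (k + 1 : ℕ)) := by
    intro k
    induction k with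
    | zero => simp [Real.Gamma_add_one ha.ne']
    | succ k ih =>
      have hp : 0 < a + (k + 1 : ℕ) := by positivity
      rw [Nat.cast_succ (k + 1), ← add_assoc, Real.Gamma_add_one hp.ne']
      have := Real.Gamma_pos_of_pos hp
      have h1 : 1 ≤ a + (k + 1 : ℕ) := by push_cast; linarith [(Nat.cast_nonneg k : (0 : ℝ) ≤ k)]
      nlinarith
  cases k with
  | zero => simpa using mul_le_of_le_one_left hG.le (min_le_right a 1)
  | succ k => exact (mul_le_mul_of_nonneg_right (min_le_left a 1) hG.le).trans (h k)

lemma summable_poissonWeight_mul_gammaPDFReal {a lam x : ℝ} (ha : 0 < a) (hl : 0 ≤ lam)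
    (hx : 0 < x) :
    Summable fun k : ℕ => poissonWeight lam k * gammaPDFReal (a + k) (1 / 2) x := by
  have hc : 0 < min a 1 * Real.Gamma a := mul_pos (lt_min ha one_pos) (Real.Gamma_pos_of_pos ha)
  refine Summable.of_nonneg_of_le
    (fun k => mul_nonneg (poissonWeight_nonneg hl k)
      (gammaPDFReal_nonneg (by positivity) one_half_pos x)) (fun k => ?_)
    ((Real.summable_pow_div_factorial (lam / 2 * (1 / 2 * x))).mul_left
      (Real.exp (-(lam / 2)) * ((1 / 2) ^ a * x ^ (a - 1) * Real.exp (-(1 / 2 * x)) /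
        (min a 1 * Real.Gamma a))))
  have e : x ^ (a + k - 1) = x ^ (a - 1) * x ^ k := by
    rw [show a + k - 1 = a - 1 + k by ring, Real.rpow_add hx, Real.rpow_natCast]
  simp only [poissonWeight, gammaPDFReal, hx.le, if_true]
  rw [e, Real.rpow_add one_half_pos, Real.rpow_natCast]
  calc _ = Real.exp (-(lam / 2)) * (lam / 2 * (1 / 2 * x)) ^ k / k.factorial *
        ((1 / 2) ^ a * x ^ (a - 1) * Real.exp (-(1 / 2 * x))) / Real.Gamma (a + k) := by
        rw [mul_pow, mul_pow]; ring
    _ ≤ Real.exp (-(lam / 2)) * (lam / 2 * (1 / 2 * x)) ^ k / k.factorial *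
        ((1 / 2) ^ a * x ^ (a - 1) * Real.exp (-(1 / 2 * x))) / (min a 1 * Real.Gamma a) :=
        div_le_div_of_nonneg_left (by positivity) hc (Gamma_add_nat_lower_bound ha k)
    _ = _ := by ring

lemma ncChiSqPdf_eq_tsum {r lam x : ℝ} (hl : 0 ≤ lam) (hx : 0 < x) :
    ncChiSqPdf r lam x = ∑' k : ℕ, poissonWeight lam k * gammaPDFReal (r / 2 + k) (1 / 2) x := by
  rcases hl.eq_or_lt with rfl | hl
  · rw [ncChiSqPdf_zero_eq r hx, tsum_eq_single 0]
    · simp [poissonWeight]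
    · intro k hk
      simp [poissonWeight, hk]
  · simp_rw [← besselI_term_eq hl hx]
    rw [tsum_mul_left]
    simp [ncChiSqPdf, not_le.2 hx, hl.ne', besselI]

lemma ncChiSq_eq_gammaMixture {r lam : ℝ} (hr : 0 < r) (hl : 0 ≤ lam) :
    ncChiSq r lam = gammaMixture (r / 2) lam := by
  have h : gammaMixture (r / 2) lam = volume.withDensity
      (∑' k : ℕ, ENNReal.ofReal (poissonWeight lam k) • gammaPDF (r / 2 + k) (1 / 2)) := by
    rw [withDensity_tsum fun k => (measurable_gammaPDF _ _).const_smul _]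
    simp only [gammaMixture, gammaMeasure, withDensity_smul _ (measurable_gammaPDF _ _)]
  rw [h, ncChiSq]
  refine withDensity_congr_ae ?_
  filter_upwards [Measure.ae_ne volume (0 : ℝ)] with x hx0
  rw [tsum_apply (Pi.summable.2 fun _ => ENNReal.summable)]
  simp only [Pi.smul_apply, smul_eq_mul]
  rcases lt_or_gt_of_ne hx0 with hx | hx
  · simp [ncChiSqPdf, hx.le, gammaPDF_of_neg hx]
  · have hpos : ∀ k : ℕ, 0 < r / 2 + k := fun k => by positivity
    rw [ncChiSqPdf_eq_tsum hl hx, ENNReal.ofReal_tsum_of_nonneg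
      (fun k => mul_nonneg (poissonWeight_nonneg hl k)
        (gammaPDFReal_nonneg (hpos k) one_half_pos x))
      (summable_poissonWeight_mul_gammaPDFReal (by positivity) hl hx)]
    simp_rw [ENNReal.ofReal_mul (poissonWeight_nonneg hl _), gammaPDF]

/-- The Stein operator `A₂` evaluated on a function and its first three derivatives. -/
def steinOp (r lam : ℝ) (h₀ h₁ h₂ h₃ : ℝ → ℝ) (x : ℝ) : ℝ :=
  8 * x * h₃ x + (8 * r - 4 * x) * h₂ x - (2 * x + 4 * r + 2 * lam) * h₁ x + (x - lam) * h₀ x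

/-- A function with its first three derivatives. -/
structure DerivChain (h₀ h₁ h₂ h₃ : ℝ → ℝ) : Prop where
  deriv₀ : ∀ x, HasDerivAt h₀ (h₁ x) x
  deriv₁ : ∀ x, HasDerivAt h₁ (h₂ x) x
  deriv₂ : ∀ x, HasDerivAt h₂ (h₃ x) x

/-- A bounded function with its first three derivatives, all bounded and continuous. -/
structure BddDerivChain (h₀ h₁ h₂ h₃ : ℝ → ℝ) : Prop extends DerivChain h₀ h₁ h₂ h₃ where
  bdd₀ : BddCont h₀
  bdd₁ : BddCont h₁
  bdd₂ : BddCont h₂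
  bdd₃ : BddCont h₃

/-- `μ` annihilates the Stein operator on bounded functions with bounded derivatives. -/
def AnnihilatesBdd (r lam : ℝ) (μ : Measure ℝ) : Prop :=
  ∀ h₀ h₁ h₂ h₃ : ℝ → ℝ, BddDerivChain h₀ h₁ h₂ h₃ → ∫ x, steinOp r lam h₀ h₁ h₂ h₃ x ∂μ = 0

lemma measurable_fst_sub_snd : Measurable fun p : ℝ × ℝ => p.1 - p.2 :=
  measurable_fst.sub measurable_snd

lemma integral_prod_noncentral {a lam : ℝ} (ha : 0 < a) (hl : 0 ≤ lam) (ν : Measure ℝ)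
    [IsProbabilityMeasure ν] {g g' g'' : ℝ → ℝ}
    (hd : ∀ x, HasDerivAt g (g' x) x) (hd' : ∀ x, HasDerivAt g' (g'' x) x)
    (hg : BddCont g) (hg' : BddCont g') (hg'' : BddCont g'') :
    Integrable (fun p : ℝ × ℝ =>
      p.1 * ((g (p.1 - p.2) - 2 * g' (p.1 - p.2)) - 2 * (g' (p.1 - p.2) - 2 * g'' (p.1 - p.2))) -
      (2 * a * (g (p.1 - p.2) - 2 * g' (p.1 - p.2)) + lam * g (p.1 - p.2)))
      ((gammaMixture a lam).prod ν) ∧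
    ∫ p : ℝ × ℝ,
      (p.1 * ((g (p.1 - p.2) - 2 * g' (p.1 - p.2)) - 2 * (g' (p.1 - p.2) - 2 * g'' (p.1 - p.2))) -
      (2 * a * (g (p.1 - p.2) - 2 * g' (p.1 - p.2)) + lam * g (p.1 - p.2)))
      ∂((gammaMixture a lam).prod ν) = 0 := by
  have := isProbabilityMeasure_gammaMixture ha hl
  have hb := hg.sub (hg'.const_mul 2)
  have hb' := hg'.sub (hg''.const_mul 2)
  have hm : AEMeasurable (fun p : ℝ × ℝ => p.1 - p.2) ((gammaMixture a lam).prod ν) :=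
    measurable_fst_sub_snd.aemeasurable
  have hint := ((hb.sub (hb'.const_mul 2)).integrable_mul_comp hm
    ((integrable_id_gammaMixture ha hl).comp_fst ν)).sub
      (((hb.const_mul (2 * a)).add (hg.const_mul lam)).integrable_comp hm)
  refine ⟨hint, ?_⟩
  refine (integral_prod_symm _ hint).trans (integral_eq_zero_of_ae (ae_of_all _ fun y => ?_))
  have hc : Continuous fun x : ℝ => x - y := by fun_prop
  have hm' : AEMeasurable (fun x : ℝ => x) (gammaMixture a lam) := aemeasurable_id'
  have hs := gammaMixture_stein ha hl (g := fun x => g (x - y)) (g' := fun x => g' (x - y))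
    (g'' := fun x => g'' (x - y)) (fun x => (hd (x - y)).comp_sub_const x y)
    (fun x => (hd' (x - y)).comp_sub_const x y) (hg.comp hc) (hg'.comp hc) (hg''.comp hc)
  simp only [Pi.zero_apply, Pi.sub_apply]
  rw [integral_sub, integral_add, integral_const_mul, integral_const_mul, hs, sub_self]
  · exact ((hb.const_mul (2 * a)).comp hc).integrable_comp hm'
  · exact ((hg.const_mul lam).comp hc).integrable_comp hm'
  · exact ((hb.sub (hb'.const_mul 2)).comp hc).integrable_mul_comp hm'
      (integrable_id_gammaMixture ha hl)
  · exact (((hb.const_mul (2 * a)).add (hg.const_mul lam)).comp hc).integrable_comp hm'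

lemma integral_prod_central {a : ℝ} (ha : 0 < a) (μ : Measure ℝ) [IsProbabilityMeasure μ]
    {k k' : ℝ → ℝ} (hd : ∀ x, HasDerivAt k (k' x) x) (hk : BddCont k) (hk' : BddCont k') :
    Integrable (fun p : ℝ × ℝ => p.2 * (k (p.1 - p.2) - 2 * (-1 * k' (p.1 - p.2))) -
      2 * a * k (p.1 - p.2)) (μ.prod (gammaMixture a 0)) ∧
    ∫ p : ℝ × ℝ, (p.2 * (k (p.1 - p.2) - 2 * (-1 * k' (p.1 - p.2))) -
      2 * a * k (p.1 - p.2)) ∂(μ.prod (gammaMixture a 0)) = 0 := by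
  have := isProbabilityMeasure_gammaMixture ha le_rfl
  have hn := hk'.const_mul (-1)
  have hb := hk.sub (hn.const_mul 2)
  have hm : AEMeasurable (fun p : ℝ × ℝ => p.1 - p.2) (μ.prod (gammaMixture a 0)) :=
    measurable_fst_sub_snd.aemeasurable
  have hint := (hb.integrable_mul_comp hm
    ((integrable_id_gammaMixture ha le_rfl).comp_snd μ)).sub
      ((hk.const_mul (2 * a)).integrable_comp hm)
  refine ⟨hint, ?_⟩
  refine (integral_prod _ hint).trans (integral_eq_zero_of_ae (ae_of_all _ fun y => ?_))
  have hc : Continuous fun x : ℝ => y - x := by fun_prop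
  have hm' : AEMeasurable (fun x : ℝ => x) (gammaMixture a 0) := aemeasurable_id'
  have hs := gammaMixture_zero_stein ha (g := fun x => k (y - x)) (g' := fun x => -1 * k' (y - x))
    (fun x => by simpa using (hd (y - x)).comp_const_sub y x) (hk.comp hc) (hn.comp hc)
  simp only [Pi.zero_apply, Pi.sub_apply]
  rw [integral_sub, integral_const_mul, hs, sub_self]
  · exact (hb.comp hc).integrable_mul_comp hm' (integrable_id_gammaMixture ha le_rfl)
  · exact ((hk.const_mul (2 * a)).comp hc).integrable_comp hm'

lemma isProbabilityMeasure_ncChiSqDiff {r lam : ℝ} (hr : 0 < r) (hl : 0 ≤ lam) :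
    IsProbabilityMeasure (ncChiSqDiff r lam 0) := by
  have := isProbabilityMeasure_gammaMixture (half_pos hr) hl
  have := isProbabilityMeasure_gammaMixture (half_pos hr) le_rfl
  rw [ncChiSqDiff, ncChiSq_eq_gammaMixture hr hl, ncChiSq_eq_gammaMixture hr le_rfl]
  exact Measure.isProbabilityMeasure_map measurable_fst_sub_snd.aemeasurable

lemma integrable_id_ncChiSqDiff {r lam : ℝ} (hr : 0 < r) (hl : 0 ≤ lam) :
    Integrable (fun x => x) (ncChiSqDiff r lam 0) := by
  have := isProbabilityMeasure_gammaMixture (half_pos hr) hl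
  have := isProbabilityMeasure_gammaMixture (half_pos hr) le_rfl
  rw [ncChiSqDiff, ncChiSq_eq_gammaMixture hr hl, ncChiSq_eq_gammaMixture hr le_rfl,
    integrable_map_measure (g := fun x => x) aestronglyMeasurable_id
      measurable_fst_sub_snd.aemeasurable]
  exact ((integrable_id_gammaMixture (half_pos hr) hl).comp_fst _).sub
    ((integrable_id_gammaMixture (half_pos hr) le_rfl).comp_snd _)

lemma continuous_steinOp (r lam : ℝ) {h₀ h₁ h₂ h₃ : ℝ → ℝ} (c₀ : Continuous h₀)
    (c₁ : Continuous h₁) (c₂ : Continuous h₂) (c₃ : Continuous h₃) :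
    Continuous (steinOp r lam h₀ h₁ h₂ h₃) := by
  unfold steinOp
  fun_prop

lemma annihilatesBdd_ncChiSqDiff {r lam : ℝ} (hr : 0 < r) (hl : 0 ≤ lam) :
    AnnihilatesBdd r lam (ncChiSqDiff r lam 0) := by
  intro h₀ h₁ h₂ h₃ h
  have ha := half_pos hr
  have := isProbabilityMeasure_gammaMixture ha hl
  have := isProbabilityMeasure_gammaMixture ha le_rfl
  rw [ncChiSqDiff, ncChiSq_eq_gammaMixture hr hl, ncChiSq_eq_gammaMixture hr le_rfl,
    integral_map measurable_fst_sub_snd.aemeasurable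
      (continuous_steinOp r lam h.bdd₀.1 h.bdd₁.1 h.bdd₂.1 h.bdd₃.1).aestronglyMeasurable]
  obtain ⟨i1, e1⟩ := integral_prod_noncentral ha hl (gammaMixture (r / 2) 0)
    (fun x => (h.deriv₀ x).add ((h.deriv₁ x).const_mul 2))
    (fun x => (h.deriv₁ x).add ((h.deriv₂ x).const_mul 2))
    (h.bdd₀.add (h.bdd₁.const_mul 2)) (h.bdd₁.add (h.bdd₂.const_mul 2))
    (h.bdd₂.add (h.bdd₃.const_mul 2))
  obtain ⟨i2, e2⟩ := integral_prod_central ha (gammaMixture (r / 2) lam)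
    (fun x => ((h.deriv₀ x).sub ((h.deriv₁ x).const_mul 4)).add ((h.deriv₂ x).const_mul 4))
    ((h.bdd₀.sub (h.bdd₁.const_mul 4)).add (h.bdd₂.const_mul 4))
    ((h.bdd₁.sub (h.bdd₂.const_mul 4)).add (h.bdd₃.const_mul 4))
  have key := integral_sub i1 i2
  rw [e1, e2, sub_zero] at key
  refine Eq.trans (integral_congr_ae (ae_of_all _ fun p => ?_)) key
  simp only [steinOp, Pi.add_apply, Pi.sub_apply]
  ring

lemma BddCont.of_hasCompactSupport {g : ℝ → ℝ} (hg : Continuous g) (hs : HasCompactSupport g) :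
    BddCont g := ⟨hg, hg.bounded_above_of_compact_support hs⟩

lemma DerivChain.const_comp_mul {h₀ h₁ h₂ h₃ : ℝ → ℝ} (h : DerivChain h₀ h₁ h₂ h₃) (e : ℝ) :
    DerivChain (fun x => h₀ (e * x)) (fun x => e * h₁ (e * x)) (fun x => e ^ 2 * h₂ (e * x))
      (fun x => e ^ 3 * h₃ (e * x)) := by
  have hc : ∀ {g g' : ℝ → ℝ}, (∀ x, HasDerivAt g (g' x) x) →
      ∀ x, HasDerivAt (fun x => g (e * x)) (e * g' (e * x)) x := fun hg x => by
    have h1 : HasDerivAt (fun x => e * x) e x := by simpa using (hasDerivAt_id x).const_mul e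
    exact ((hg (e * x)).comp x h1).congr_deriv (mul_comm _ _)
  exact ⟨hc h.deriv₀, fun x => ((hc h.deriv₁ x).const_mul e).congr_deriv (by ring),
    fun x => ((hc h.deriv₂ x).const_mul (e ^ 2)).congr_deriv (by ring)⟩

lemma DerivChain.mul {f₀ f₁ f₂ f₃ c₀ c₁ c₂ c₃ : ℝ → ℝ} (f : DerivChain f₀ f₁ f₂ f₃)
    (c : DerivChain c₀ c₁ c₂ c₃) :
    DerivChain (fun x => f₀ x * c₀ x) (fun x => f₁ x * c₀ x + f₀ x * c₁ x)
      (fun x => f₂ x * c₀ x + 2 * (f₁ x * c₁ x) + f₀ x * c₂ x)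
      (fun x => f₃ x * c₀ x + 3 * (f₂ x * c₁ x) + 3 * (f₁ x * c₂ x) + f₀ x * c₃ x) where
  deriv₀ x := (f.deriv₀ x).mul (c.deriv₀ x)
  deriv₁ x := (((f.deriv₁ x).mul (c.deriv₀ x)).add ((f.deriv₀ x).mul (c.deriv₁ x))).congr_deriv
    (by ring)
  deriv₂ x := ((((f.deriv₂ x).mul (c.deriv₀ x)).add
    (((f.deriv₁ x).mul (c.deriv₁ x)).const_mul 2)).add
      ((f.deriv₀ x).mul (c.deriv₂ x))).congr_deriv (by ring)

lemma ContDiff.derivChain {f : ℝ → ℝ} (hf : ContDiff ℝ 3 f) :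
    DerivChain f (iteratedDeriv 1 f) (iteratedDeriv 2 f) (iteratedDeriv 3 f) := by
  have h : ∀ j : ℕ, j < 3 → ∀ x,
      HasDerivAt (iteratedDeriv j f) (iteratedDeriv (j + 1) f x) x := fun j hj x => by
    rw [iteratedDeriv_succ]
    exact (hf.differentiable_iteratedDeriv j (by exact_mod_cast hj) x).hasDerivAt
  exact ⟨fun x => by simpa using h 0 (by norm_num) x, h 1 (by norm_num), h 2 (by norm_num)⟩

lemma HasCompactSupport.iteratedDeriv {f : ℝ → ℝ} (hf : HasCompactSupport f) (n : ℕ) :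
    HasCompactSupport (iteratedDeriv n f) := by
  induction n with
  | zero => simpa using hf
  | succ n ih =>
    rw [iteratedDeriv_succ]
    exact ih.deriv

lemma exists_cutoff : ∃ c₀ c₁ c₂ c₃ : ℝ → ℝ, DerivChain c₀ c₁ c₂ c₃ ∧ c₀ 0 = 1 ∧
    ∀ g ∈ [c₀, c₁, c₂, c₃], Continuous g ∧ HasCompactSupport g := by
  let b : ContDiffBump (0 : ℝ) := ⟨1, 2, one_pos, one_lt_two⟩
  have hb : ContDiff ℝ 3 b := b.contDiff
  have hs : HasCompactSupport b := b.hasCompactSupport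
  refine ⟨b, iteratedDeriv 1 b, iteratedDeriv 2 b, iteratedDeriv 3 b, hb.derivChain,
    b.one_of_mem_closedBall (by simp [b]), ?_⟩
  simp only [List.mem_cons, List.not_mem_nil, or_false, forall_eq_or_imp, forall_eq]
  exact ⟨⟨hb.continuous, hs⟩,
    ⟨hb.continuous_iteratedDeriv 1 (by norm_num), hs.iteratedDeriv 1⟩,
    ⟨hb.continuous_iteratedDeriv 2 (by norm_num), hs.iteratedDeriv 2⟩,
    ⟨hb.continuous_iteratedDeriv 3 (by norm_num), hs.iteratedDeriv 3⟩⟩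

lemma BddCont.mul_comp_mul {f c : ℝ → ℝ} (hf : Continuous f) (hc : Continuous c)
    (hs : HasCompactSupport c) {e : ℝ} (he : e ≠ 0) : BddCont fun x => f x * c (e * x) := by
  refine BddCont.of_hasCompactSupport (hf.mul (by fun_prop)) ?_
  have h : HasCompactSupport fun x => c (e * x) :=
    hs.comp_homeomorph (Homeomorph.mulLeft₀ e he)
  exact h.mul_left (f := f)

lemma abs_steinOp_le {r lam : ℝ} (hr : 0 < r) (hl : 0 ≤ lam) {h₀ h₁ h₂ h₃ : ℝ → ℝ} {x B D : ℝ}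
    (b₀ : |h₀ x| ≤ B) (b₁ : |h₁ x| ≤ B) (b₂ : |h₂ x| ≤ B)
    (d₀ : |x * h₀ x| ≤ D) (d₁ : |x * h₁ x| ≤ D) (d₂ : |x * h₂ x| ≤ D) (d₃ : |x * h₃ x| ≤ D) :
    |steinOp r lam h₀ h₁ h₂ h₃ x| ≤ 15 * D + (12 * r + 3 * lam) * B := by
  have e : steinOp r lam h₀ h₁ h₂ h₃ x = 8 * (x * h₃ x) + 8 * (r * h₂ x) - 4 * (x * h₂ x)
      - 2 * (x * h₁ x) - 4 * (r * h₁ x) - 2 * (lam * h₁ x) + x * h₀ x - lam * h₀ x := by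
    unfold steinOp
    ring
  have hm : ∀ {s t : ℝ}, 0 ≤ s → |t| ≤ B → |s * t| ≤ s * B := fun hs ht => by
    rw [abs_mul, abs_of_nonneg hs]
    exact mul_le_mul_of_nonneg_left ht hs
  have r₁ := abs_le.1 (hm hr.le b₁)
  have r₂ := abs_le.1 (hm hr.le b₂)
  have l₀ := abs_le.1 (hm hl b₀)
  have l₁ := abs_le.1 (hm hl b₁)
  rw [abs_le] at d₀ d₁ d₂ d₃
  rw [e, abs_le]
  constructor <;> linarith [d₀.1, d₀.2, d₁.1, d₁.2, d₂.1, d₂.2, d₃.1, d₃.2, r₁.1, r₁.2, r₂.1, r₂.2,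
    l₀.1, l₀.2, l₁.1, l₁.2]

lemma abs_leibniz_le {y₀ y₁ y₂ y₃ k₀ k₁ k₂ k₃ C : ℝ} (b₀ : |k₀| ≤ C) (b₁ : |k₁| ≤ C)
    (b₂ : |k₂| ≤ C) (b₃ : |k₃| ≤ C) :
    |y₀ * k₀| ≤ 3 * C * (|y₀| + |y₁| + |y₂| + |y₃|) ∧
    |y₁ * k₀ + y₀ * k₁| ≤ 3 * C * (|y₀| + |y₁| + |y₂| + |y₃|) ∧
    |y₂ * k₀ + 2 * (y₁ * k₁) + y₀ * k₂| ≤ 3 * C * (|y₀| + |y₁| + |y₂| + |y₃|) ∧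
    |y₃ * k₀ + 3 * (y₂ * k₁) + 3 * (y₁ * k₂) + y₀ * k₃| ≤
      3 * C * (|y₀| + |y₁| + |y₂| + |y₃|) := by
  have hC : 0 ≤ C := (abs_nonneg _).trans b₀
  have hm : ∀ y : ℝ, ∀ k ∈ [k₀, k₁, k₂, k₃], -(C * |y|) ≤ y * k ∧ y * k ≤ C * |y| := by
    intro y k hk
    have hk' : |k| ≤ C := by
      simp only [List.mem_cons, List.not_mem_nil, or_false] at hk
      rcases hk with rfl | rfl | rfl | rfl <;> assumption
    rw [← abs_le, abs_mul, mul_comm]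
    exact mul_le_mul_of_nonneg_right hk' (abs_nonneg _)
  have m₀ := fun y => hm y k₀ (by simp)
  have m₁ := fun y => hm y k₁ (by simp)
  have m₂ := fun y => hm y k₂ (by simp)
  have m₃ := fun y => hm y k₃ (by simp)
  have p := fun y : ℝ => mul_nonneg hC (abs_nonneg y)
  simp only [abs_le]
  refine ⟨⟨?_, ?_⟩, ⟨?_, ?_⟩, ⟨?_, ?_⟩, ⟨?_, ?_⟩⟩ <;>
    linarith [(m₀ y₀).1, (m₀ y₀).2, (m₀ y₁).1, (m₀ y₁).2, (m₀ y₂).1, (m₀ y₂).2, (m₀ y₃).1,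
      (m₀ y₃).2, (m₁ y₀).1, (m₁ y₀).2, (m₁ y₁).1, (m₁ y₁).2, (m₁ y₂).1, (m₁ y₂).2, (m₂ y₀).1,
      (m₂ y₀).2, (m₂ y₁).1, (m₂ y₁).2, (m₃ y₀).1, (m₃ y₀).2, p y₀, p y₁, p y₂, p y₃]

/-- A measure annihilating the Stein operator on bounded functions annihilates it on all functions
satisfying the integrability conditions. -/
lemma AnnihilatesBdd.integral_eq_zero {r lam : ℝ} (hr : 0 < r) (hl : 0 ≤ lam) {μ : Measure ℝ}
    (hμ : AnnihilatesBdd r lam μ) {f₀ f₁ f₂ f₃ : ℝ → ℝ} (f : DerivChain f₀ f₁ f₂ f₃)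
    (hf₃ : Continuous f₃) (i₀ : Integrable f₀ μ) (i₁ : Integrable f₁ μ) (i₂ : Integrable f₂ μ)
    (j₀ : Integrable (fun x => x * f₀ x) μ) (j₁ : Integrable (fun x => x * f₁ x) μ)
    (j₂ : Integrable (fun x => x * f₂ x) μ) (j₃ : Integrable (fun x => x * f₃ x) μ) :
    ∫ x, steinOp r lam f₀ f₁ f₂ f₃ x ∂μ = 0 := by
  obtain ⟨c₀, c₁, c₂, c₃, c, c_zero, hc⟩ := exists_cutoff
  simp only [List.mem_cons, List.not_mem_nil, or_false, forall_eq_or_imp, forall_eq] at hc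
  obtain ⟨⟨cc₀, cs₀⟩, ⟨cc₁, cs₁⟩, ⟨cc₂, cs₂⟩, ⟨cc₃, cs₃⟩⟩ := hc
  obtain ⟨C, hC₀, hC₁, hC₂, hC₃⟩ : ∃ C, (∀ x, |c₀ x| ≤ C) ∧ (∀ x, |c₁ x| ≤ C) ∧
      (∀ x, |c₂ x| ≤ C) ∧ ∀ x, |c₃ x| ≤ C := by
    obtain ⟨C₀, h₀⟩ := cc₀.bounded_above_of_compact_support cs₀
    obtain ⟨C₁, h₁⟩ := cc₁.bounded_above_of_compact_support cs₁
    obtain ⟨C₂, h₂⟩ := cc₂.bounded_above_of_compact_support cs₂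
    obtain ⟨C₃, h₃⟩ := cc₃.bounded_above_of_compact_support cs₃
    exact ⟨max (max C₀ C₁) (max C₂ C₃), fun x => (h₀ x).trans (by simp),
      fun x => (h₁ x).trans (by simp), fun x => (h₂ x).trans (by simp),
      fun x => (h₃ x).trans (by simp)⟩
  have cf₀ : Continuous f₀ := continuous_iff_continuousAt.2 fun x => (f.deriv₀ x).continuousAt
  have cf₁ : Continuous f₁ := continuous_iff_continuousAt.2 fun x => (f.deriv₁ x).continuousAt
  have cf₂ : Continuous f₂ := continuous_iff_continuousAt.2 fun x => (f.deriv₂ x).continuousAt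
  let S : ℝ → ℝ → ℝ := fun e => steinOp r lam (fun x => f₀ x * c₀ (e * x))
    (fun x => f₁ x * c₀ (e * x) + f₀ x * (e * c₁ (e * x)))
    (fun x => f₂ x * c₀ (e * x) + 2 * (f₁ x * (e * c₁ (e * x))) + f₀ x * (e ^ 2 * c₂ (e * x)))
    (fun x => f₃ x * c₀ (e * x) + 3 * (f₂ x * (e * c₁ (e * x))) +
      3 * (f₁ x * (e ^ 2 * c₂ (e * x))) + f₀ x * (e ^ 3 * c₃ (e * x)))
  have hS : ∀ e, e ≠ 0 → ∫ x, S e x ∂μ = 0 := by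
    intro e he
    have hb : ∀ {g k : ℝ → ℝ}, Continuous g → Continuous k → HasCompactSupport k → ∀ n : ℕ,
        BddCont fun x => g x * (e ^ n * k (e * x)) := fun hg hk hs n => by
      convert! (BddCont.mul_comp_mul hg hk hs he).const_mul (e ^ n) using 2
      ring
    have hb0 : ∀ {g k : ℝ → ℝ}, Continuous g → Continuous k → HasCompactSupport k →
        BddCont fun x => g x * k (e * x) := fun hg hk hs => BddCont.mul_comp_mul hg hk hs he
    have hb1 : ∀ {g k : ℝ → ℝ}, Continuous g → Continuous k → HasCompactSupport k →
        BddCont fun x => g x * (e * k (e * x)) := fun hg hk hs => by simpa using hb hg hk hs 1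
    exact hμ _ _ _ _ ⟨f.mul (c.const_comp_mul e), hb0 cf₀ cc₀ cs₀,
      (hb0 cf₁ cc₀ cs₀).add (hb1 cf₀ cc₁ cs₁),
      ((hb0 cf₂ cc₀ cs₀).add ((hb1 cf₁ cc₁ cs₁).const_mul 2)).add (hb cf₀ cc₂ cs₂ 2),
      (((hb0 hf₃ cc₀ cs₀).add ((hb1 cf₂ cc₁ cs₁).const_mul 3)).add
        ((hb cf₁ cc₂ cs₂ 2).const_mul 3)).add (hb cf₀ cc₃ cs₃ 3)⟩
  have hcontS : ∀ e, Continuous (S e) := fun e =>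
    continuous_steinOp r lam (by fun_prop) (by fun_prop) (by fun_prop) (by fun_prop)
  let bound : ℝ → ℝ := fun x =>
    15 * (3 * C * (|x * f₀ x| + |x * f₁ x| + |x * f₂ x| + |x * f₃ x|)) +
      (12 * r + 3 * lam) * (3 * C * (|f₀ x| + |f₁ x| + |f₂ x|))
  have hbound_int : Integrable bound μ :=
    ((((((j₀.abs.add j₁.abs).add j₂.abs).add j₃.abs).const_mul (3 * C)).const_mul 15)).add
      ((((i₀.abs.add i₁.abs).add i₂.abs).const_mul (3 * C)).const_mul (12 * r + 3 * lam))
  have hbound : ∀ e : ℝ, 0 ≤ e → e ≤ 1 → ∀ x, |S e x| ≤ bound x := by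
    intro e he0 he1 x
    have hk : ∀ {k : ℝ}, |k| ≤ C → ∀ n : ℕ, |e ^ n * k| ≤ C := fun hk n => by
      rw [abs_mul, abs_of_nonneg (pow_nonneg he0 n)]
      exact (mul_le_of_le_one_left (abs_nonneg _) (pow_le_one₀ he0 he1)).trans hk
    have k₀ := hC₀ (e * x)
    have k₁ := hk (hC₁ (e * x)) 1
    have k₂ := hk (hC₂ (e * x)) 2
    have k₃ := hk (hC₃ (e * x)) 3
    rw [pow_one] at k₁
    obtain ⟨b₀, b₁, b₂, -⟩ := abs_leibniz_le (y₀ := f₀ x) (y₁ := f₁ x) (y₂ := f₂ x) (y₃ := 0)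
      k₀ k₁ k₂ k₃
    obtain ⟨d₀, d₁, d₂, d₃⟩ := abs_leibniz_le (y₀ := x * f₀ x) (y₁ := x * f₁ x)
      (y₂ := x * f₂ x) (y₃ := x * f₃ x) k₀ k₁ k₂ k₃
    rw [abs_zero, add_zero] at b₀ b₁ b₂
    refine abs_steinOp_le hr hl b₀ b₁ b₂ ?_ ?_ ?_ ?_
    · convert! d₀ using 2
      ring
    · convert! d₁ using 2
      ring
    · convert! d₂ using 2
      ring
    · convert! d₃ using 2
      ring
  have hlim : ∀ x, Filter.Tendsto (fun n : ℕ => S (1 / ((n : ℝ) + 1)) x) Filter.atTop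
      (nhds (steinOp r lam f₀ f₁ f₂ f₃ x)) := by
    intro x
    have hcont : Continuous fun e => S e x := by
      simp only [S, steinOp]
      fun_prop
    have h := (hcont.tendsto 0).comp (tendsto_one_div_add_atTop_nhds_zero_nat (𝕜 := ℝ))
    have h0 : S 0 x = steinOp r lam f₀ f₁ f₂ f₃ x := by simp [S, steinOp, c_zero]
    rwa [h0] at h
  have hdc := tendsto_integral_of_dominated_convergence (μ := μ) bound
    (fun n : ℕ => (hcontS (1 / ((n : ℝ) + 1))).aestronglyMeasurable) hbound_int
    (fun n => ae_of_all _ (hbound _ (by positivity)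
      (by rw [div_le_one (by positivity)]; linarith [(Nat.cast_nonneg n : (0 : ℝ) ≤ n)])))
    (ae_of_all _ hlim)
  refine tendsto_nhds_unique hdc ?_
  simp_rw [fun n : ℕ => hS (1 / ((n : ℝ) + 1)) (by positivity)]
  exact tendsto_const_nhds


lemma bddDerivChain_cos (t : ℝ) : BddDerivChain (fun x => Real.cos (t * x))
    (fun x => t * -Real.sin (t * x)) (fun x => t ^ 2 * -Real.cos (t * x))
    (fun x => t ^ 3 * Real.sin (t * x)) := by
  have hc : BddCont Real.cos := ⟨Real.continuous_cos, 1, Real.abs_cos_le_one⟩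
  have hs : BddCont Real.sin := ⟨Real.continuous_sin, 1, Real.abs_sin_le_one⟩
  have ht : Continuous fun x => t * x := by fun_prop
  have h : DerivChain Real.cos (fun x => -Real.sin x) (fun x => -Real.cos x) Real.sin :=
    ⟨Real.hasDerivAt_cos, fun x => (Real.hasDerivAt_sin x).neg,
      fun x => (Real.hasDerivAt_cos x).neg.congr_deriv (neg_neg _)⟩
  have hc' : BddCont fun x => -Real.cos x := by simpa using hc.const_mul (-1)
  have hs' : BddCont fun x => -Real.sin x := by simpa using hs.const_mul (-1)
  exact ⟨h.const_comp_mul t, hc.comp ht, (hs'.comp ht).const_mul _, (hc'.comp ht).const_mul _,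
    (hs.comp ht).const_mul _⟩

lemma bddDerivChain_sin (t : ℝ) : BddDerivChain (fun x => Real.sin (t * x))
    (fun x => t * Real.cos (t * x)) (fun x => t ^ 2 * -Real.sin (t * x))
    (fun x => t ^ 3 * -Real.cos (t * x)) := by
  have hc : BddCont Real.cos := ⟨Real.continuous_cos, 1, Real.abs_cos_le_one⟩
  have hs : BddCont Real.sin := ⟨Real.continuous_sin, 1, Real.abs_sin_le_one⟩
  have ht : Continuous fun x => t * x := by fun_prop
  have h : DerivChain Real.sin Real.cos (fun x => -Real.sin x) (fun x => -Real.cos x) :=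
    ⟨Real.hasDerivAt_sin, Real.hasDerivAt_cos, fun x => (Real.hasDerivAt_sin x).neg⟩
  have hc' : BddCont fun x => -Real.cos x := by simpa using hc.const_mul (-1)
  have hs' : BddCont fun x => -Real.sin x := by simpa using hs.const_mul (-1)
  exact ⟨h.const_comp_mul t, hs.comp ht, (hc.comp ht).const_mul _, (hs'.comp ht).const_mul _,
    (hc'.comp ht).const_mul _⟩

lemma hasDerivAt_charFun {μ : Measure ℝ} [IsProbabilityMeasure μ]
    (hμ : Integrable (fun x => x) μ) (t : ℝ) :
    HasDerivAt (charFun μ) (Complex.I * ∫ x, x * Complex.exp (t * x * Complex.I) ∂μ) t := by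
  have hm : MemLp id (1 : ℕ) μ := by
    rw [Nat.cast_one, memLp_one_iff_integrable]
    exact hμ
  have h := ((contDiff_charFun hm).differentiable (by norm_num) t).hasDerivAt
  rw [← iteratedDeriv_one, iteratedDeriv_charFun hm] at h
  simpa using h

/-- The coefficient of the linear differential equation solved by the characteristic function. -/
def charFunLogDeriv (r lam t : ℝ) : ℂ :=
  Complex.I * (8 * r * t ^ 2 + 4 * r * (t * Complex.I) + 2 * lam * (t * Complex.I) + lam) /
    ((1 - 2 * (t * Complex.I)) ^ 2 * (1 + 2 * (t * Complex.I)))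

lemma one_add_mul_I_ne_zero (a : ℝ) : (1 + a * Complex.I : ℂ) ≠ 0 := fun h => by
  simpa using congrArg Complex.re h

lemma charFunLogDeriv_denom_ne_zero (t : ℝ) :
    ((1 - 2 * (t * Complex.I)) ^ 2 * (1 + 2 * (t * Complex.I)) : ℂ) ≠ 0 := by
  have h1 := one_add_mul_I_ne_zero (2 * t)
  have h2 := one_add_mul_I_ne_zero (-2 * t)
  push_cast at h1 h2
  refine mul_ne_zero (pow_ne_zero 2 ?_) ?_
  · convert! h2 using 1
    ring
  · convert! h1 using 1
    ring

lemma continuous_charFunLogDeriv (r lam : ℝ) : Continuous (charFunLogDeriv r lam) := by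
  unfold charFunLogDeriv
  exact Continuous.div (by fun_prop) (by fun_prop) charFunLogDeriv_denom_ne_zero

lemma AnnihilatesBdd.hasDerivAt_charFun {r lam : ℝ} {μ : Measure ℝ} [IsProbabilityMeasure μ]
    (h : AnnihilatesBdd r lam μ) (hμ : Integrable (fun x => x) μ) (t : ℝ) :
    HasDerivAt (charFun μ) (charFunLogDeriv r lam t * charFun μ t) t := by
  convert _root_.hasDerivAt_charFun hμ t using 1
  have e1 := h _ _ _ _ (bddDerivChain_cos t)
  have e2 := h _ _ _ _ (bddDerivChain_sin t)
  have hc : BddCont fun x => Real.cos (t * x) := (bddDerivChain_cos t).bdd₀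
  have hs : BddCont fun x => Real.sin (t * x) := (bddDerivChain_sin t).bdd₀
  have ic := hc.integrable_comp (aemeasurable_id (μ := μ))
  have is := hs.integrable_comp (aemeasurable_id (μ := μ))
  have ixc := hc.integrable_mul_comp (aemeasurable_id (μ := μ)) hμ
  have ixs := hs.integrable_mul_comp (aemeasurable_id (μ := μ)) hμ
  simp only [id] at ic is ixc ixs
  have hexp : ∀ x : ℝ, Complex.exp (t * x * Complex.I) =
      (Real.cos (t * x) : ℝ) + (Real.sin (t * x) : ℝ) * Complex.I := fun x => by
    rw [Complex.exp_mul_I]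
    push_cast
    rfl
  have hlin : ∀ a b c d : ℝ, ∫ x, (a * (x * Real.sin (t * x)) + b * (x * Real.cos (t * x)) +
      c * Real.sin (t * x) + d * Real.cos (t * x)) ∂μ =
      a * ∫ x, x * Real.sin (t * x) ∂μ + b * ∫ x, x * Real.cos (t * x) ∂μ +
      c * ∫ x, Real.sin (t * x) ∂μ + d * ∫ x, Real.cos (t * x) ∂μ := fun a b c d => by
    have i₂ : Integrable (fun x => a * (x * Real.sin (t * x)) + b * (x * Real.cos (t * x))) μ :=
      (ixs.const_mul a).add (ixc.const_mul b)
    have i₃ : Integrable (fun x => a * (x * Real.sin (t * x)) + b * (x * Real.cos (t * x)) +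
        c * Real.sin (t * x)) μ := i₂.add (is.const_mul c)
    rw [integral_add i₃ (ic.const_mul d), integral_add i₂ (is.const_mul c),
      integral_add (ixs.const_mul a) (ixc.const_mul b)]
    simp only [integral_const_mul]
  have f1 := (hlin (8 * t ^ 3 + 2 * t) (1 + 4 * t ^ 2) ((4 * r + 2 * lam) * t)
    (-8 * r * t ^ 2 - lam)).symm.trans ((integral_congr_ae (ae_of_all _ fun x => by
      simp only [steinOp]
      ring)).trans e1)
  have f2 := (hlin (1 + 4 * t ^ 2) (-8 * t ^ 3 - 2 * t) (-8 * r * t ^ 2 - lam)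
    (-(4 * r + 2 * lam) * t)).symm.trans ((integral_congr_ae (ae_of_all _ fun x => by
      simp only [steinOp]
      ring)).trans e2)
  have hφ : charFun μ t = ((∫ x, Real.cos (t * x) ∂μ : ℝ) : ℂ) +
      ((∫ x, Real.sin (t * x) ∂μ : ℝ) : ℂ) * Complex.I := by
    rw [charFun_apply_real]
    simp_rw [hexp]
    rw [integral_add ic.ofReal (is.ofReal.mul_const _), integral_mul_const, integral_complex_ofReal,
      integral_complex_ofReal]
  have hψ : ∫ x, x * Complex.exp (t * x * Complex.I) ∂μ =
      ((∫ x, x * Real.cos (t * x) ∂μ : ℝ) : ℂ) +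
      ((∫ x, x * Real.sin (t * x) ∂μ : ℝ) : ℂ) * Complex.I := by
    simp_rw [hexp, mul_add, ← mul_assoc, ← Complex.ofReal_mul]
    rw [integral_add ixc.ofReal (ixs.ofReal.mul_const _), integral_mul_const,
      integral_complex_ofReal, integral_complex_ofReal]
  rw [hφ, hψ, charFunLogDeriv, div_mul_eq_mul_div,
    div_eq_iff (charFunLogDeriv_denom_ne_zero t)]
  generalize (∫ x, x * Real.cos (t * x) ∂μ) = XC at *
  generalize (∫ x, x * Real.sin (t * x) ∂μ) = XS at *
  generalize (∫ x, Real.cos (t * x) ∂μ) = C at *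
  generalize (∫ x, Real.sin (t * x) ∂μ) = S at *
  apply Complex.ext
  · simp [pow_succ]
    linarith
  · simp [pow_succ]
    linarith

lemma eq_of_hasDerivAt_mul {G φ₁ φ₂ : ℝ → ℂ} (hG : Continuous G)
    (h₁ : ∀ t, HasDerivAt φ₁ (G t * φ₁ t) t) (h₂ : ∀ t, HasDerivAt φ₂ (G t * φ₂ t) t)
    (h0 : φ₁ 0 = φ₂ 0) : φ₁ = φ₂ := by
  let E : ℝ → ℂ := fun t => Complex.exp (-∫ u in (0 : ℝ)..t, G u)
  have hE : ∀ t, HasDerivAt E (E t * -G t) t := fun t =>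
    (hG.integral_hasStrictDerivAt 0 t).hasDerivAt.neg.cexp
  have hd : ∀ t, HasDerivAt (fun t => E t * (φ₁ t - φ₂ t)) 0 t := fun t =>
    ((hE t).mul ((h₁ t).sub (h₂ t))).congr_deriv (by simp only [Pi.sub_apply]; ring)
  funext t
  have h := is_const_of_deriv_eq_zero (fun t => (hd t).differentiableAt) (fun t => (hd t).deriv) t 0
  simpa [h0, E, Complex.exp_ne_zero, sub_eq_zero] using h

lemma AnnihilatesBdd.measure_eq {r lam : ℝ} {μ ν : Measure ℝ} [IsProbabilityMeasure μ]
    [IsProbabilityMeasure ν] (hμ : AnnihilatesBdd r lam μ) (hν : AnnihilatesBdd r lam ν)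
    (iμ : Integrable (fun x => x) μ) (iν : Integrable (fun x => x) ν) : μ = ν :=
  Measure.ext_of_charFun (eq_of_hasDerivAt_mul (continuous_charFunLogDeriv r lam)
    (hμ.hasDerivAt_charFun iμ) (hν.hasDerivAt_charFun iν) (by simp))

lemma DerivChain.iteratedDeriv_eq {h₀ h₁ h₂ h₃ : ℝ → ℝ} (h : DerivChain h₀ h₁ h₂ h₃) :
    iteratedDeriv 1 h₀ = h₁ ∧ iteratedDeriv 2 h₀ = h₂ ∧ iteratedDeriv 3 h₀ = h₃ := by
  have e1 : iteratedDeriv 1 h₀ = h₁ := by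
    rw [iteratedDeriv_one]
    exact funext fun x => (h.deriv₀ x).deriv
  have e2 : iteratedDeriv 2 h₀ = h₂ := by
    rw [iteratedDeriv_succ, e1]
    exact funext fun x => (h.deriv₁ x).deriv
  refine ⟨e1, e2, ?_⟩
  rw [iteratedDeriv_succ, e2]
  exact funext fun x => (h.deriv₂ x).deriv

lemma DerivChain.contDiff {h₀ h₁ h₂ h₃ : ℝ → ℝ} (h : DerivChain h₀ h₁ h₂ h₃)
    (hc : Continuous h₃) : ContDiff ℝ 3 h₀ := by
  have step : ∀ {n : ℕ} {g g' : ℝ → ℝ}, (∀ x, HasDerivAt g (g' x) x) → ContDiff ℝ n g' →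
      ContDiff ℝ (n + 1) g := fun {n g g'} hg hg' => by
    have hd : deriv g = g' := funext fun x => (hg x).deriv
    rw [contDiff_succ_iff_deriv, hd]
    exact ⟨fun x => (hg x).differentiableAt, by simp, hg'⟩
  have c2 : ContDiff ℝ ((1 : ℕ) : WithTop ℕ∞) h₂ := by
    simpa using step h.deriv₂ (n := 0) (by simpa using (contDiff_zero (𝕜 := ℝ)).2 hc)
  have c1 : ContDiff ℝ ((2 : ℕ) : WithTop ℕ∞) h₁ := by
    exact_mod_cast step h.deriv₁ c2
  exact_mod_cast step h.deriv₀ c1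

/-- Stein characterisation in the case `λ₂ = 0`. Let `T = V₁ - V₂` with
`V₁ ~ χ'²_r(λ₁)` and `V₂ ~ χ'²_r(0)` independent, `r > 0`, `λ₁ ≥ 0`, and let `W` be a
real-valued random variable with `E|W| < ∞`. With
`A₂ f (x) = 8x f‴(x) + (8r - 4x) f″(x) - (2x + 4r + 2λ₁) f′(x) + (x - λ₁) f(x)`,
we have `W =_d T` iff `E[A₂ f (W)] = 0` for all `f ∈ F₃(W)`. -/
theorem ncChiSqDiff_stein_characterisation_lam2_zero {Ω : Type*} [MeasurableSpace Ω]
    (P : Measure Ω) [IsProbabilityMeasure P] (r lam1 : ℝ) (hr : 0 < r) (h1 : 0 ≤ lam1)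
    (W : Ω → ℝ) (hW : Measurable W) (hWint : Integrable W P) :
    Measure.map W P = ncChiSqDiff r lam1 0 ↔
      ∀ f : ℝ → ℝ, ContDiff ℝ 3 f →
        (∀ j : ℕ, j ≤ 2 → Integrable (fun ω => iteratedDeriv j f (W ω)) P) →
        (∀ j : ℕ, j ≤ 3 → Integrable (fun ω => W ω * iteratedDeriv j f (W ω)) P) →
        ∫ ω, (8 * W ω * iteratedDeriv 3 f (W ω)
            + (8 * r - 4 * W ω) * iteratedDeriv 2 f (W ω)
            - (2 * W ω + 4 * r + 2 * lam1) * iteratedDeriv 1 f (W ω)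
            + (W ω - lam1) * f (W ω)) ∂P = 0 := by
  have hWm : AEMeasurable W P := hW.aemeasurable
  have hWid : Integrable (fun x => x) (Measure.map W P) :=
    (integrable_map_measure (g := fun x => x) aestronglyMeasurable_id hWm).2 hWint
  have hmap : ∀ {h₀ h₁ h₂ h₃ : ℝ → ℝ}, Continuous h₀ → Continuous h₁ → Continuous h₂ →
      Continuous h₃ → ∫ x, steinOp r lam1 h₀ h₁ h₂ h₃ x ∂Measure.map W P =
        ∫ ω, steinOp r lam1 h₀ h₁ h₂ h₃ (W ω) ∂P := fun c₀ c₁ c₂ c₃ =>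
    integral_map hWm (continuous_steinOp r lam1 c₀ c₁ c₂ c₃).aestronglyMeasurable
  constructor
  · intro h f hf hi hj
    have hT : AnnihilatesBdd r lam1 (Measure.map W P) := h ▸ annihilatesBdd_ncChiSqDiff hr h1
    have hc : ∀ j : ℕ, j ≤ 3 → Continuous (iteratedDeriv j f) := fun j hj =>
      hf.continuous_iteratedDeriv j (by exact_mod_cast hj)
    have hi' : ∀ j : ℕ, j ≤ 2 → Integrable (iteratedDeriv j f) (Measure.map W P) := fun j hj =>
      (integrable_map_measure (hc j (by lia)).aestronglyMeasurable hWm).2 (hi j hj)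
    have hj' : ∀ j : ℕ, j ≤ 3 → Integrable (fun x => x * iteratedDeriv j f x) (Measure.map W P) :=
      fun j h3 => (integrable_map_measure
        (continuous_id.mul (hc j h3)).aestronglyMeasurable hWm).2 (hj j h3)
    have key := hT.integral_eq_zero hr h1 hf.derivChain (hc 3 le_rfl)
      (by simpa using hi' 0 (by norm_num)) (hi' 1 (by norm_num)) (hi' 2 le_rfl)
      (by simpa using hj' 0 (by norm_num)) (hj' 1 (by norm_num)) (hj' 2 (by norm_num))
      (hj' 3 le_rfl)
    rwa [hmap hf.continuous (hc 1 (by norm_num)) (hc 2 (by norm_num)) (hc 3 le_rfl)] at key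
  · intro h
    have := Measure.isProbabilityMeasure_map hWm
    have := isProbabilityMeasure_ncChiSqDiff hr h1
    have hP : AnnihilatesBdd r lam1 (Measure.map W P) := by
      intro h₀ h₁ h₂ h₃ hh
      obtain ⟨e₁, e₂, e₃⟩ := hh.toDerivChain.iteratedDeriv_eq
      have hb : ∀ j : ℕ, j ≤ 3 → BddCont (iteratedDeriv j h₀) := fun j hj => by
        interval_cases j
        · simpa using hh.bdd₀
        · exact e₁ ▸ hh.bdd₁
        · exact e₂ ▸ hh.bdd₂
        · exact e₃ ▸ hh.bdd₃
      have key := h h₀ (hh.toDerivChain.contDiff hh.bdd₃.1)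
        (fun j hj => (hb j (by lia)).integrable_comp hWm)
        (fun j hj => (hb j hj).integrable_mul_comp hWm hWint)
      rw [e₁, e₂, e₃] at key
      rw [hmap hh.bdd₀.1 hh.bdd₁.1 hh.bdd₂.1 hh.bdd₃.1]
      exact key
    exact hP.measure_eq (annihilatesBdd_ncChiSqDiff hr h1) hWid (integrable_id_ncChiSqDiff hr h1)

end
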